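/- arXiv:2005.12223 — 2 statements merged into one kernel-verified Lean document; each statement's English description precedes it below -/
import Mathlib

section
/- Let ξ, δ ∈ ℝ and 1 ≤ p < ∞. The Hardy-type operator H₀^ξ is of strong type (p,p) with respect to (ℝ₊, x^δ dx) if and only if δ < (ξ+1)p − 1. Moreover, H₀^ξ is of strong type (∞,∞) if and only if ξ > −1. -/
open MeasureTheory Set ENNReal
open scoped NNReal

noncomputable section

/-- The measure `x^δ dx` on `(0,∞)`. -/
def powMeasure (δ : ℝ) : Measure ℝ :=
  (volume.restrict (Ioi (0:ℝ))).withDensity (fun x => ENNReal.ofReal (x ^ δ))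

/-- `f ∈ L^p(ℝ₊, x^δ dx)` for a real exponent `p`. -/
def MemLpPow (f : ℝ → ℝ) (p δ : ℝ) : Prop :=
  AEMeasurable f (powMeasure δ) ∧
    ∫⁻ x, ENNReal.ofReal |f x| ^ p ∂(powMeasure δ) < ⊤

/-- `T` is of strong type `(p,p)` with respect to `(ℝ₊, x^δ dx)`. -/
def IsStrongType (T : (ℝ → ℝ) → (ℝ → ℝ)) (p δ : ℝ) : Prop :=
  ∃ C : ℝ≥0, ∀ f : ℝ → ℝ, MemLpPow f p δ →
    ∫⁻ x, ENNReal.ofReal |T f x| ^ p ∂(powMeasure δ) ≤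
      C * ∫⁻ x, ENNReal.ofReal |f x| ^ p ∂(powMeasure δ)

/-- `T` is of strong type `(∞,∞)`, i.e. bounded on `L^∞(ℝ₊, dx)`. -/
def IsStrongTypeInfty (T : (ℝ → ℝ) → (ℝ → ℝ)) : Prop :=
  ∃ C : ℝ≥0, ∀ f : ℝ → ℝ,
    eLpNorm (T f) ⊤ (volume.restrict (Ioi (0:ℝ))) ≤
      C * eLpNorm f ⊤ (volume.restrict (Ioi (0:ℝ)))

/-- The Hardy-type operator `H₀^ξ`. -/
def H0 (ξ : ℝ) (f : ℝ → ℝ) (x : ℝ) : ℝ :=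
  x ^ (-ξ - 1) * ∫ y in Ioo (0:ℝ) x, f y * y ^ ξ

/-- The power weight `x ^ a` with values in `ℝ≥0∞`. -/
def powWeight (a x : ℝ) : ℝ≥0∞ := ENNReal.ofReal (x ^ a)

lemma measurable_powWeight (a : ℝ) : Measurable (powWeight a) := by
  unfold powWeight
  fun_prop

lemma powWeight_mul {x : ℝ} (hx : 0 < x) (a b : ℝ) :
    powWeight a x * powWeight b x = powWeight (a + b) x := by
  rw [powWeight, powWeight, powWeight, ← ENNReal.ofReal_mul (by positivity), Real.rpow_add hx]

lemma powWeight_rpow {x : ℝ} (hx : 0 < x) (a p : ℝ) :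
    powWeight a x ^ p = powWeight (a * p) x := by
  rw [powWeight, powWeight, ENNReal.ofReal_rpow_of_pos (by positivity), ← Real.rpow_mul hx.le]

lemma lintegral_powMeasure (δ : ℝ) (g : ℝ → ℝ≥0∞) :
    ∫⁻ x, g x ∂(powMeasure δ) = ∫⁻ x in Ioi (0 : ℝ), powWeight δ x * g x := by
  rw [powMeasure, lintegral_withDensity_eq_lintegral_mul_non_measurable _ (by fun_prop)
    (by simp)]
  rfl

lemma lintegral_powWeight_Ioo {s x : ℝ} (hs : 0 < s) (hx : 0 < x) :
    ∫⁻ y in Ioo 0 x, powWeight (s - 1) y = ENNReal.ofReal s⁻¹ * powWeight s x := by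
  have hi : IntegrableOn (fun y : ℝ => y ^ (s - 1)) (Ioo 0 x) := by
    have h := intervalIntegral.intervalIntegrable_rpow' (a := 0) (b := x) (r := s - 1)
      (by linarith)
    rw [intervalIntegrable_iff_integrableOn_Ioc_of_le hx.le] at h
    exact h.mono_set Ioo_subset_Ioc_self
  have h0 : 0 ≤ᵐ[volume.restrict (Ioo 0 x)] fun y : ℝ => y ^ (s - 1) := by
    filter_upwards [ae_restrict_mem measurableSet_Ioo] with y hy
    exact Real.rpow_nonneg hy.1.le _
  simp only [powWeight]
  rw [← ofReal_integral_eq_lintegral_ofReal hi h0, ← integral_Ioc_eq_integral_Ioo,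
    ← intervalIntegral.integral_of_le hx.le, integral_rpow (Or.inl (by linarith)),
    ← ENNReal.ofReal_mul (by positivity)]
  congr 1
  rw [sub_add_cancel, Real.zero_rpow hs.ne']
  ring

lemma lintegral_powWeight_Ioi {b y : ℝ} (hb : b < -1) (hy : 0 < y) :
    ∫⁻ x in Ioi y, powWeight b x = ENNReal.ofReal (-(b + 1))⁻¹ * powWeight (b + 1) y := by
  have h0 : 0 ≤ᵐ[volume.restrict (Ioi y)] fun x : ℝ => x ^ b := by
    filter_upwards [ae_restrict_mem measurableSet_Ioi] with x hx
    exact Real.rpow_nonneg (hy.trans hx).le _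
  have hb' : 0 < -(b + 1) := by linarith
  simp only [powWeight]
  rw [← ofReal_integral_eq_lintegral_ofReal (integrableOn_Ioi_rpow_of_lt hb hy) h0,
    integral_Ioi_rpow_of_lt hb hy, ← ENNReal.ofReal_mul (by positivity)]
  congr 1
  rw [neg_div, ← div_neg, div_eq_inv_mul]

lemma lintegral_powWeight_Ioi_eq_top {b y : ℝ} (hb : -1 ≤ b) (hy : 0 < y) :
    ∫⁻ x in Ioi y, powWeight b x = ⊤ := by
  by_contra h
  have h0 : 0 ≤ᵐ[volume.restrict (Ioi y)] fun x : ℝ => x ^ b := by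
    filter_upwards [ae_restrict_mem measurableSet_Ioi] with x hx
    exact Real.rpow_nonneg (hy.trans hx).le _
  have hi : IntegrableOn (fun x : ℝ => x ^ b) (Ioi y) :=
    ⟨by fun_prop, (hasFiniteIntegral_iff_ofReal h0).2 (lt_top_iff_ne_top.2 h)⟩
  exact absurd ((integrableOn_Ioi_rpow_iff hy).1 hi) (by linarith)

lemma lintegral_mul_lintegral_Ioo_swap {u F : ℝ → ℝ≥0∞} (hu : Measurable u) (hF : Measurable F) :
    ∫⁻ x in Ioi (0 : ℝ), u x * ∫⁻ y in Ioo 0 x, F y =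
      ∫⁻ y in Ioi (0 : ℝ), F y * ∫⁻ x in Ioi y, u x := by
  have hS : MeasurableSet {z : ℝ × ℝ | z.2 < z.1} := measurableSet_lt measurable_snd measurable_fst
  have hm : Measurable (({z : ℝ × ℝ | z.2 < z.1}).indicator fun z => u z.1 * F z.2) :=
    ((hu.comp measurable_fst).mul (hF.comp measurable_snd)).indicator hS
  have key := lintegral_lintegral_swap (μ := volume.restrict (Ioi (0 : ℝ)))
    (ν := volume.restrict (Ioi (0 : ℝ)))
    (f := fun x y => ({z : ℝ × ℝ | z.2 < z.1}).indicator (fun z => u z.1 * F z.2) (x, y))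
    hm.aemeasurable
  convert key using 1
  · refine setLIntegral_congr_fun measurableSet_Ioi fun x _ => ?_
    have h1 : (fun y => ({z : ℝ × ℝ | z.2 < z.1}).indicator (fun z => u z.1 * F z.2) (x, y)) =
        (Iio x).indicator fun y => u x * F y := rfl
    rw [h1, lintegral_indicator measurableSet_Iio, Measure.restrict_restrict measurableSet_Iio,
      lintegral_const_mul _ hF, inter_comm, Ioi_inter_Iio]
  · refine setLIntegral_congr_fun measurableSet_Ioi fun y hy => ?_
    have h1 : (fun x => ({z : ℝ × ℝ | z.2 < z.1}).indicator (fun z => u z.1 * F z.2) (x, y)) =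
        (Ioi y).indicator fun x => u x * F y := rfl
    rw [h1, lintegral_indicator measurableSet_Ioi, Measure.restrict_restrict measurableSet_Ioi,
      lintegral_mul_const _ hu, inter_eq_left.2 (Ioi_subset_Ioi (le_of_lt hy)), mul_comm]

/-- Hölder's inequality on `(0, x)` against the weight `y ^ (s - 1)`. -/
lemma rpow_lintegral_Ioo_mul_powWeight_le {G : ℝ → ℝ≥0∞} (hG : Measurable G) {ξ p s x : ℝ}
    (hp : 1 ≤ p) (hs : 0 < s) (hx : 0 < x) :
    (∫⁻ y in Ioo 0 x, G y * powWeight ξ y) ^ p ≤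
      (∫⁻ y in Ioo 0 x, G y ^ p * powWeight (ξ * p - (s - 1) * (p - 1)) y) *
        (ENNReal.ofReal s⁻¹ ^ (p - 1) * powWeight (s * (p - 1)) x) := by
  have hp0 : 0 < p := by linarith
  have hq : 0 ≤ 1 - p⁻¹ := sub_nonneg.2 (inv_le_one_of_one_le₀ hp)
  have h := ENNReal.lintegral_mul_norm_pow_le (μ := volume.restrict (Ioo 0 x))
    (f := fun y => G y ^ p * powWeight (ξ * p - (s - 1) * (p - 1)) y) (g := powWeight (s - 1))
    ((hG.pow_const p).mul (measurable_powWeight _)).aemeasurable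
    (measurable_powWeight _).aemeasurable (p := p⁻¹) (q := 1 - p⁻¹) (by positivity) hq (by ring)
  have h2 : ∫⁻ y in Ioo 0 x, (G y ^ p * powWeight (ξ * p - (s - 1) * (p - 1)) y) ^ p⁻¹ *
      powWeight (s - 1) y ^ (1 - p⁻¹) = ∫⁻ y in Ioo 0 x, G y * powWeight ξ y := by
    refine setLIntegral_congr_fun measurableSet_Ioo fun y hy => ?_
    rw [ENNReal.mul_rpow_of_nonneg _ _ (by positivity), ← ENNReal.rpow_mul,
      mul_inv_cancel₀ hp0.ne', ENNReal.rpow_one, powWeight_rpow hy.1, powWeight_rpow hy.1,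
      mul_assoc, powWeight_mul hy.1]
    congr 2
    field_simp
    ring
  rw [h2, lintegral_powWeight_Ioo hs hx] at h
  refine (ENNReal.rpow_le_rpow h hp0.le).trans_eq ?_
  rw [ENNReal.mul_rpow_of_nonneg _ _ hp0.le, ← ENNReal.rpow_mul, ← ENNReal.rpow_mul,
    inv_mul_cancel₀ hp0.ne', ENNReal.rpow_one,
    show (1 - p⁻¹) * p = p - 1 by field_simp, ENNReal.mul_rpow_of_nonneg _ _ (by linarith),
    powWeight_rpow hx]

/-- The weighted Hardy inequality for nonnegative functions. -/
lemma lintegral_hardy_le {G : ℝ → ℝ≥0∞} (hG : Measurable G) {ξ δ p s : ℝ}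
    (hp : 1 ≤ p) (hs : 0 < s) (hsδ : δ - (ξ + 1) * p + s * (p - 1) < -1) :
    ∫⁻ x in Ioi (0 : ℝ), powWeight δ x *
        (powWeight (-ξ - 1) x * ∫⁻ y in Ioo 0 x, G y * powWeight ξ y) ^ p ≤
      ENNReal.ofReal s⁻¹ ^ (p - 1) *
        ENNReal.ofReal (-(δ - (ξ + 1) * p + s * (p - 1) + 1))⁻¹ *
          ∫⁻ x in Ioi (0 : ℝ), powWeight δ x * G x ^ p := by
  set b := δ - (ξ + 1) * p + s * (p - 1) with hb
  set a := ξ * p - (s - 1) * (p - 1) with ha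
  have hF : Measurable fun y => G y ^ p * powWeight a y :=
    (hG.pow_const p).mul (measurable_powWeight _)
  calc
    _ ≤ ∫⁻ x in Ioi (0 : ℝ), ENNReal.ofReal s⁻¹ ^ (p - 1) * powWeight b x *
          ∫⁻ y in Ioo 0 x, G y ^ p * powWeight a y := by
      refine setLIntegral_mono' measurableSet_Ioi fun x hx => ?_
      have hx : 0 < x := hx
      rw [ENNReal.mul_rpow_of_nonneg _ _ (by linarith), powWeight_rpow hx, ← mul_assoc,
        powWeight_mul hx]
      refine (mul_le_mul_right (rpow_lintegral_Ioo_mul_powWeight_le hG hp hs hx) _).trans_eq ?_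
      have hw : powWeight b x =
          powWeight (δ + (-ξ - 1) * p) x * powWeight (s * (p - 1)) x := by
        rw [powWeight_mul hx, hb]
        ring_nf
      rw [hw]
      ring
    _ = ∫⁻ y in Ioi (0 : ℝ), G y ^ p * powWeight a y *
          ∫⁻ x in Ioi y, ENNReal.ofReal s⁻¹ ^ (p - 1) * powWeight b x :=
      lintegral_mul_lintegral_Ioo_swap ((measurable_powWeight b).const_mul _) hF
    _ = ∫⁻ y in Ioi (0 : ℝ), ENNReal.ofReal s⁻¹ ^ (p - 1) * ENNReal.ofReal (-(b + 1))⁻¹ *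
          (powWeight δ y * G y ^ p) := by
      refine setLIntegral_congr_fun measurableSet_Ioi fun y hy => ?_
      have hy : 0 < y := hy
      have hw : powWeight δ y = powWeight a y * powWeight (b + 1) y := by
        rw [powWeight_mul hy, ha, hb]
        ring_nf
      rw [lintegral_const_mul _ (measurable_powWeight b), lintegral_powWeight_Ioi hsδ hy, hw]
      ring
    _ = _ := lintegral_const_mul _ ((measurable_powWeight δ).mul (hG.pow_const p))

lemma ofReal_abs_H0_le (ξ : ℝ) (f : ℝ → ℝ) {x : ℝ} (hx : 0 < x) :
    ENNReal.ofReal |H0 ξ f x| ≤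
      powWeight (-ξ - 1) x * ∫⁻ y in Ioo 0 x, ENNReal.ofReal |f y| * powWeight ξ y := by
  rw [H0, abs_mul, ENNReal.ofReal_mul (abs_nonneg _), abs_of_nonneg (by positivity)]
  refine mul_le_mul_right ?_ _
  rw [← Real.enorm_eq_ofReal_abs]
  refine (enorm_integral_le_lintegral_enorm _).trans_eq ?_
  refine setLIntegral_congr_fun measurableSet_Ioo fun y hy => ?_
  rw [Real.enorm_eq_ofReal_abs, abs_mul, ENNReal.ofReal_mul (abs_nonneg _), powWeight,
    abs_of_nonneg (Real.rpow_nonneg hy.1.le _)]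

lemma isStrongType_H0 {ξ δ p : ℝ} (hp : 1 ≤ p) (h : δ < (ξ + 1) * p - 1) :
    IsStrongType (H0 ξ) p δ := by
  obtain ⟨s, hs, hsδ⟩ : ∃ s : ℝ, 0 < s ∧ δ - (ξ + 1) * p + s * (p - 1) < -1 := by
    have hd : 0 < (ξ + 1) * p - 1 - δ := by linarith
    refine ⟨((ξ + 1) * p - 1 - δ) / p, by positivity, ?_⟩
    rw [mul_sub, div_mul_cancel₀ _ (by positivity)]
    have : 0 < ((ξ + 1) * p - 1 - δ) / p := by positivity
    linarith
  have hCtop : ENNReal.ofReal s⁻¹ ^ (p - 1) *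
      ENNReal.ofReal (-(δ - (ξ + 1) * p + s * (p - 1) + 1))⁻¹ ≠ ⊤ :=
    ENNReal.mul_ne_top (ENNReal.rpow_ne_top_of_nonneg (by linarith) ENNReal.ofReal_ne_top)
      ENNReal.ofReal_ne_top
  refine ⟨(ENNReal.ofReal s⁻¹ ^ (p - 1) *
      ENNReal.ofReal (-(δ - (ξ + 1) * p + s * (p - 1) + 1))⁻¹).toNNReal, fun f hf => ?_⟩
  rw [ENNReal.coe_toNNReal hCtop, lintegral_powMeasure, lintegral_powMeasure]
  have hac : volume.restrict (Ioi (0 : ℝ)) ≪ powMeasure δ := by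
    refine withDensity_absolutelyContinuous' (by fun_prop) ?_
    filter_upwards [ae_restrict_mem measurableSet_Ioi] with x hx
    simpa using Real.rpow_pos_of_pos hx δ
  have hfm : AEMeasurable f (volume.restrict (Ioi (0 : ℝ))) := hf.1.mono_ac hac
  set g := hfm.mk f
  have hfg : f =ᵐ[volume.restrict (Ioi (0 : ℝ))] g := hfm.ae_eq_mk
  have hg : Measurable fun y => ENNReal.ofReal |g y| :=
    (measurable_norm.comp hfm.measurable_mk).ennreal_ofReal
  calc
    _ ≤ ∫⁻ x in Ioi (0 : ℝ), powWeight δ x * (powWeight (-ξ - 1) x *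
          ∫⁻ y in Ioo 0 x, ENNReal.ofReal |g y| * powWeight ξ y) ^ p := by
      refine setLIntegral_mono' measurableSet_Ioi fun x hx => ?_
      have hfgx : f =ᵐ[volume.restrict (Ioo 0 x)] g :=
        ae_restrict_of_ae_restrict_of_subset Ioo_subset_Ioi_self hfg
      have hx := ofReal_abs_H0_le ξ f hx
      rw [lintegral_congr_ae (g := fun y => ENNReal.ofReal |g y| * powWeight ξ y)
        (by filter_upwards [hfgx] with y hy; rw [hy])] at hx
      gcongr
    _ ≤ _ := lintegral_hardy_le hg hp hs hsδ
    _ = _ := by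
      congr 1
      refine lintegral_congr_ae ?_
      filter_upwards [hfg] with y hy
      rw [hy]

lemma lt_of_isStrongType_H0 {ξ δ p : ℝ} (hp : 1 ≤ p) (h : IsStrongType (H0 ξ) p δ) :
    δ < (ξ + 1) * p - 1 := by
  by_contra! hδ
  obtain ⟨C, hC⟩ := h
  have hp0 : 0 < p := by linarith
  have hint (a : ℝ) : IntegrableOn (fun y : ℝ => y ^ a) (Ioo 1 2) := by
    refine IntegrableOn.mono_set ?_ Ioo_subset_Icc_self
    refine ContinuousOn.integrableOn_Icc fun y hy => ?_
    exact (Real.continuousAt_rpow_const _ _ (Or.inl (by linarith [hy.1]))).continuousWithinAt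
  set f : ℝ → ℝ := (Ioo (1 : ℝ) 2).indicator 1 with hf
  have hfin : ∫⁻ x, ENNReal.ofReal |f x| ^ p ∂(powMeasure δ) < ⊤ := by
    rw [lintegral_powMeasure]
    have h1 (x : ℝ) : powWeight δ x * ENNReal.ofReal |f x| ^ p =
        (Ioo (1 : ℝ) 2).indicator (powWeight δ) x := by
      by_cases hx : x ∈ Ioo (1 : ℝ) 2
      · simp [hf, hx]
      · simp [hf, hx, hp0]
    simp_rw [h1]
    refine (setLIntegral_le_lintegral _ _).trans_lt ?_
    rw [lintegral_indicator measurableSet_Ioo]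
    exact (hint δ).lintegral_lt_top
  set c := ∫ y in Ioo (1 : ℝ) 2, y ^ ξ with hc
  have hcpos : 0 < c := by
    rw [hc, ← integral_Ioc_eq_integral_Ioo, ← intervalIntegral.integral_of_le (by norm_num)]
    refine intervalIntegral.intervalIntegral_pos_of_pos_on ?_
      (fun y hy => Real.rpow_pos_of_pos (by linarith [hy.1]) _) (by norm_num)
    rw [intervalIntegrable_iff_integrableOn_Ioo_of_le (by norm_num)]
    exact hint ξ
  have hH (x : ℝ) (hx : 2 < x) : H0 ξ f x = x ^ (-ξ - 1) * c := by
    rw [H0, hc]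
    congr 1
    have h1 (y : ℝ) : f y * y ^ ξ = (Ioo (1 : ℝ) 2).indicator (fun y => y ^ ξ) y := by
      by_cases hy : y ∈ Ioo (1 : ℝ) 2 <;> simp [hf, hy]
    simp_rw [h1]
    rw [setIntegral_indicator measurableSet_Ioo,
      inter_eq_right.2 (Ioo_subset_Ioo (by norm_num) hx.le)]
  have htop : ∫⁻ x, ENNReal.ofReal |H0 ξ f x| ^ p ∂(powMeasure δ) = ⊤ := by
    rw [lintegral_powMeasure, eq_top_iff]
    calc
      ⊤ = ENNReal.ofReal c ^ p * ∫⁻ x in Ioi (2 : ℝ), powWeight (δ + (-ξ - 1) * p) x := by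
        rw [lintegral_powWeight_Ioi_eq_top (by linarith) (by norm_num), ENNReal.mul_top]
        exact (ENNReal.rpow_pos (by simpa using hcpos) ENNReal.ofReal_ne_top).ne'
      _ = ∫⁻ x in Ioi (2 : ℝ), ENNReal.ofReal c ^ p * powWeight (δ + (-ξ - 1) * p) x :=
        (lintegral_const_mul _ (measurable_powWeight _)).symm
      _ = ∫⁻ x in Ioi (2 : ℝ), powWeight δ x * ENNReal.ofReal |H0 ξ f x| ^ p := by
        refine setLIntegral_congr_fun measurableSet_Ioi fun x hx => ?_
        have hx0 : 0 < x := two_pos.trans hx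
        rw [hH x hx, abs_of_nonneg (by positivity), ENNReal.ofReal_mul (by positivity),
          ENNReal.mul_rpow_of_nonneg _ _ hp0.le, ← powWeight_mul hx0, ← powWeight_rpow hx0,
          powWeight, powWeight]
        ring
      _ ≤ _ := lintegral_mono_set (Ioi_subset_Ioi (by norm_num))
  have hm : AEMeasurable f (powMeasure δ) :=
    (measurable_one.indicator measurableSet_Ioo).aemeasurable
  have := hC f ⟨hm, hfin⟩
  rw [htop, top_le_iff] at this
  exact ENNReal.mul_ne_top ENNReal.coe_ne_top hfin.ne this

lemma isStrongTypeInfty_H0 {ξ : ℝ} (h : -1 < ξ) : IsStrongTypeInfty (H0 ξ) := by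
  have hξ : 0 < ξ + 1 := by linarith
  refine ⟨(ξ + 1)⁻¹.toNNReal, fun f => ?_⟩
  rw [eLpNorm_exponent_top, eLpNorm_exponent_top]
  set M := eLpNormEssSup f (volume.restrict (Ioi (0 : ℝ)))
  refine eLpNormEssSup_le_of_ae_enorm_bound ?_
  filter_upwards [ae_restrict_mem measurableSet_Ioi] with x hx
  have hx : 0 < x := hx
  rw [Real.enorm_eq_ofReal_abs]
  calc
    _ ≤ powWeight (-ξ - 1) x * ∫⁻ y in Ioo 0 x, ENNReal.ofReal |f y| * powWeight ξ y :=
      ofReal_abs_H0_le ξ f hx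
    _ ≤ powWeight (-ξ - 1) x * ∫⁻ y in Ioo 0 x, M * powWeight ξ y := by
      refine mul_le_mul_right (lintegral_mono_ae ?_) _
      filter_upwards [ae_restrict_of_ae_restrict_of_subset Ioo_subset_Ioi_self
        (ae_le_eLpNormEssSup (f := f) (μ := volume.restrict (Ioi (0 : ℝ))))] with y hy
      rw [Real.enorm_eq_ofReal_abs] at hy
      exact mul_le_mul_left hy _
    _ = ENNReal.ofReal (ξ + 1)⁻¹ * M * (powWeight (-ξ - 1) x * powWeight (ξ + 1) x) := by
      have h1 := lintegral_powWeight_Ioo hξ hx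
      rw [add_sub_cancel_right] at h1
      rw [lintegral_const_mul _ (measurable_powWeight ξ), h1]
      ring
    _ = ENNReal.ofReal (ξ + 1)⁻¹ * M := by
      rw [powWeight_mul hx]
      simp [powWeight]

lemma log_le_H0_indicator {ξ x : ℝ} (hξ : ξ ≤ -1) (hx : 1 < x) :
    Real.log x ≤ H0 ξ ((Ioi (1 : ℝ)).indicator 1) x := by
  have hx0 : 0 < x := by linarith
  have h1 (y : ℝ) : (Ioi (1 : ℝ)).indicator (1 : ℝ → ℝ) y * y ^ ξ =
      (Ioi (1 : ℝ)).indicator (fun y => y ^ ξ) y := by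
    by_cases hy : y ∈ Ioi (1 : ℝ) <;> simp [hy]
  have hset : Ioo 0 x ∩ Ioi 1 = Ioo 1 x := by
    ext y
    simp only [mem_inter_iff, mem_Ioo, mem_Ioi]
    constructor
    · rintro ⟨⟨_, h⟩, h'⟩
      exact ⟨h', h⟩
    · rintro ⟨h', h⟩
      exact ⟨⟨by linarith, h⟩, h'⟩
  rw [H0]
  simp_rw [h1]
  rw [setIntegral_indicator measurableSet_Ioi, hset, ← integral_Ioc_eq_integral_Ioo,
    ← intervalIntegral.integral_of_le hx.le, ← intervalIntegral.integral_const_mul]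
  have hlog : ∫ y in (1 : ℝ)..x, y⁻¹ = Real.log x := by
    rw [integral_inv_of_pos one_pos hx0, div_one]
  have h0 : (0 : ℝ) ∉ uIcc 1 x := by
    rw [uIcc_of_le hx.le]
    exact fun h => absurd h.1 (by norm_num)
  rw [← hlog]
  refine intervalIntegral.integral_mono_on hx.le ?_ ?_ fun y hy => ?_
  · exact intervalIntegral.intervalIntegrable_inv (fun y hy h => h0 (h ▸ hy)) continuousOn_id
  · exact (intervalIntegral.intervalIntegrable_rpow (Or.inr h0)).const_mul _
  · have hy0 : 0 < y := by linarith [hy.1]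
    have h2 : x ^ (ξ + 1) ≤ y ^ (ξ + 1) :=
      Real.rpow_le_rpow_of_nonpos hy0 hy.2 (by linarith)
    calc
      y⁻¹ = x ^ (-ξ - 1) * (x ^ (ξ + 1) * y⁻¹) := by
        rw [← mul_assoc, ← Real.rpow_add hx0]
        simp
      _ ≤ x ^ (-ξ - 1) * (y ^ (ξ + 1) * y⁻¹) := by gcongr
      _ = x ^ (-ξ - 1) * y ^ ξ := by
        rw [Real.rpow_add_one hy0.ne', mul_inv_cancel_right₀ hy0.ne']

lemma lt_of_isStrongTypeInfty_H0 {ξ : ℝ} (h : IsStrongTypeInfty (H0 ξ)) : -1 < ξ := by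
  by_contra! hξ
  obtain ⟨C, hC⟩ := h
  set f : ℝ → ℝ := (Ioi (1 : ℝ)).indicator 1 with hf
  have hf1 : eLpNorm f ⊤ (volume.restrict (Ioi (0 : ℝ))) ≤ 1 := by
    rw [eLpNorm_exponent_top]
    refine eLpNormEssSup_le_of_ae_enorm_bound (Filter.Eventually.of_forall fun x => ?_)
    by_cases hx : x ∈ Ioi (1 : ℝ) <;> simp [hf, hx]
  have hle : eLpNormEssSup (H0 ξ f) (volume.restrict (Ioi (0 : ℝ))) ≤ C := by
    rw [← eLpNorm_exponent_top]
    exact (hC f).trans ((mul_le_mul_right hf1 _).trans_eq (mul_one _))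
  have hexp : 0 < Real.exp (C + 1) := Real.exp_pos _
  have hae : ∀ᵐ x ∂volume.restrict (Ioi (Real.exp (C + 1))), False := by
    filter_upwards [ae_restrict_of_ae_restrict_of_subset (Ioi_subset_Ioi hexp.le)
      (ae_le_eLpNormEssSup (f := H0 ξ f) (μ := volume.restrict (Ioi (0 : ℝ)))),
      ae_restrict_mem measurableSet_Ioi] with x hx hxe
    have hxe : Real.exp (C + 1) < x := hxe
    have hC0 : (0 : ℝ) ≤ C := C.2
    have hx1 : 1 < x := (Real.one_lt_exp_iff.2 (by linarith)).trans hxe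
    have h1 := log_le_H0_indicator hξ hx1
    have h2 : (C : ℝ) + 1 < Real.log x := (Real.lt_log_iff_exp_lt (by linarith)).2 hxe
    have h3 := hx.trans hle
    rw [Real.enorm_eq_ofReal_abs, ENNReal.ofReal_le_coe] at h3
    linarith [le_abs_self (H0 ξ f x)]
  rw [Filter.eventually_false_iff_eq_bot, ae_eq_bot, Measure.restrict_eq_zero] at hae
  simp at hae

theorem stmt0 (ξ δ p : ℝ) (hp : 1 ≤ p) :
    (IsStrongType (H0 ξ) p δ ↔ δ < (ξ + 1) * p - 1) ∧
    (IsStrongTypeInfty (H0 ξ) ↔ -1 < ξ) := by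
  exact ⟨⟨lt_of_isStrongType_H0 hp, isStrongType_H0 hp⟩,
    ⟨lt_of_isStrongTypeInfty_H0, isStrongTypeInfty_H0⟩⟩

end
end

section
/- Let ξ, δ ∈ ℝ and 1 ≤ p < ∞. The Hardy-type operator H₀^ξ is of restricted weak type (p,p) with respect to (ℝ₊, x^δ dx) if and only if δ ≤ (ξ+1)p − 1, with the inequality strictened to δ < (ξ+1)p − 1 in case ξ = −1. -/
open MeasureTheory Set ENNReal
open scoped NNReal

noncomputable section

/-- `T` is of weak type `(p,p)` with respect to `(ℝ₊, x^δ dx)`. -/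
def IsWeakType (T : (ℝ → ℝ) → (ℝ → ℝ)) (p δ : ℝ) : Prop :=
  ∃ C : ℝ≥0, ∀ f : ℝ → ℝ, MemLpPow f p δ → ∀ l : ℝ, 0 < l →
    ENNReal.ofReal (l ^ p) * powMeasure δ {y | l < |T f y|} ≤
      C * ∫⁻ x, ENNReal.ofReal |f x| ^ p ∂(powMeasure δ)

/-- `T` is of restricted weak type `(p,p)` with respect to `(ℝ₊, x^δ dx)`:
the weak type inequality holds uniformly over indicator functions of sets of
finite `x^δ dx` measure. -/
def IsRestrictedWeakType (T : (ℝ → ℝ) → (ℝ → ℝ)) (p δ : ℝ) : Prop :=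
  ∃ C : ℝ≥0, ∀ E : Set ℝ, MeasurableSet E → powMeasure δ E < ⊤ → ∀ l : ℝ, 0 < l →
    ENNReal.ofReal (l ^ p) * powMeasure δ {y | l < |T (E.indicator 1) y|} ≤
      C * powMeasure δ E

theorem powMeasure_apply (δ : ℝ) {s : Set ℝ} (hs : MeasurableSet s) :
    powMeasure δ s = ∫⁻ x in s ∩ Ioi 0, ENNReal.ofReal (x ^ δ) := by
  rw [powMeasure, withDensity_apply _ hs, Measure.restrict_restrict hs]

theorem lintegral_Ioc_rpow {a t : ℝ} (ha : 0 < a) (ht : 0 < t) :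
    ∫⁻ x in Ioc 0 t, ENNReal.ofReal (x ^ (a - 1)) = ENNReal.ofReal (t ^ a / a) := by
  have hi : IntervalIntegrable (fun x : ℝ => x ^ (a - 1)) volume 0 t :=
    intervalIntegral.intervalIntegrable_rpow' (by linarith)
  rw [← ofReal_integral_eq_lintegral_ofReal, ← intervalIntegral.integral_of_le ht.le,
    integral_rpow (Or.inl (by linarith))]
  · simp [Real.zero_rpow ha.ne']
  · exact (intervalIntegrable_iff_integrableOn_Ioc_of_le ht.le).1 hi
  · filter_upwards [ae_restrict_mem measurableSet_Ioc] with x hx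
    exact Real.rpow_nonneg hx.1.le _

theorem lintegral_Ioi_rpow {a t : ℝ} (ha : a < 0) (ht : 0 < t) :
    ∫⁻ x in Ioi t, ENNReal.ofReal (x ^ (a - 1)) = ENNReal.ofReal (t ^ a / (-a)) := by
  rw [← ofReal_integral_eq_lintegral_ofReal, integral_Ioi_rpow_of_lt (by linarith) ht]
  · congr 1
    rw [sub_add_cancel, div_neg, neg_div]
  · exact integrableOn_Ioi_rpow_of_lt (by linarith) ht
  · filter_upwards [ae_restrict_mem measurableSet_Ioi] with x hx
    exact Real.rpow_nonneg (ht.trans hx).le _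

/-- Sublevel sets of `x ^ d` have `x ^ (d - 1) dx` measure comparable to the level. -/
theorem lintegral_sublevel_rpow_le {d K : ℝ} (hd : d ≠ 0) :
    ∫⁻ x in {x : ℝ | 0 < x ∧ x ^ d ≤ K}, ENNReal.ofReal (x ^ (d - 1)) ≤
      ENNReal.ofReal (K / |d|) := by
  rcases le_or_gt K 0 with hK | hK
  · have : {x : ℝ | 0 < x ∧ x ^ d ≤ K} = ∅ := by
      ext x
      simp only [mem_ofPred_eq, mem_empty_iff_false, iff_false, not_and, not_le]
      exact fun hx => hK.trans_lt (Real.rpow_pos_of_pos hx d)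
    simp [this]
  have ht : 0 < K ^ d⁻¹ := Real.rpow_pos_of_pos hK _
  have htd : (K ^ d⁻¹) ^ d = K := Real.rpow_inv_rpow hK.le hd
  rcases lt_or_gt_of_ne hd with hneg | hpos
  · refine (lintegral_mono_set (t := Ici (K ^ d⁻¹)) ?_).trans_eq ?_
    · rintro x ⟨hx, hxd⟩
      rw [← htd] at hxd
      exact (Real.rpow_le_rpow_iff_of_neg hx ht hneg).1 hxd
    · rw [← restrict_Ioi_eq_restrict_Ici, lintegral_Ioi_rpow hneg ht, htd, abs_of_neg hneg]
  · refine (lintegral_mono_set (t := Ioc 0 (K ^ d⁻¹)) ?_).trans_eq ?_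
    · rintro x ⟨hx, hxd⟩
      rw [← htd] at hxd
      exact ⟨hx, (Real.rpow_le_rpow_iff hx.le ht.le hpos).1 hxd⟩
    · rw [lintegral_Ioc_rpow hpos ht, htd, abs_of_pos hpos]

theorem measurableSet_sublevel_rpow (d K : ℝ) : MeasurableSet {x : ℝ | 0 < x ∧ x ^ d ≤ K} :=
  measurableSet_Ioi.inter (measurableSet_le (f := fun x : ℝ => x ^ d) (by fun_prop) measurable_const)

/-- For indicator functions, the `L¹(x ^ (a - 1) dx)` norm is controlled by the
`L^p(x ^ (a * p - 1) dx)` norm. -/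
theorem lintegral_rpow_le_of_lintegral_rpow_eq {a p M : ℝ} (ha : a ≠ 0) (hp : 1 ≤ p)
    {E : Set ℝ} (hE : MeasurableSet E) (hE0 : E ⊆ Ioi 0) (hM0 : 0 ≤ M)
    (hM : ∫⁻ y in E, ENNReal.ofReal (y ^ (a * p - 1)) = ENNReal.ofReal M) :
    ∫⁻ y in E, ENNReal.ofReal (y ^ (a - 1)) ≤
      ENNReal.ofReal ((1 / |a| + 1) * M ^ p⁻¹) := by
  have hp0 : p ≠ 0 := by linarith
  rcases hM0.eq_or_lt with rfl | hMpos
  · have hnull : volume.restrict E = 0 := by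
      rw [ENNReal.ofReal_zero, lintegral_eq_zero_iff (by fun_prop)] at hM
      rw [← ae_eq_bot, ← Filter.empty_mem_iff_bot]
      filter_upwards [hM, ae_restrict_mem hE] with y hy hyE
      exact (ENNReal.ofReal_pos.2 (Real.rpow_pos_of_pos (hE0 hyE) _)).ne' hy
    simp [hnull]
  set K := M ^ p⁻¹ with hKdef
  have hK : 0 < K := Real.rpow_pos_of_pos hMpos _
  have hKp : K ^ p = M := Real.rpow_inv_rpow hMpos.le hp0
  set S := {y : ℝ | 0 < y ∧ y ^ a ≤ K} with hS
  have hSm : MeasurableSet S := measurableSet_sublevel_rpow a K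
  have h1 : ∫⁻ y in E ∩ S, ENNReal.ofReal (y ^ (a - 1)) ≤ ENNReal.ofReal (K / |a|) :=
    (lintegral_mono_set inter_subset_right).trans (lintegral_sublevel_rpow_le ha)
  have h2 : ∫⁻ y in E \ S, ENNReal.ofReal (y ^ (a - 1)) ≤ ENNReal.ofReal K := by
    calc ∫⁻ y in E \ S, ENNReal.ofReal (y ^ (a - 1))
        ≤ ∫⁻ y in E \ S, ENNReal.ofReal (K ^ (1 - p)) * ENNReal.ofReal (y ^ (a * p - 1)) := by
          refine setLIntegral_mono (by fun_prop) fun y hy => ?_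
          have hy0 : 0 < y := hE0 hy.1
          have hyK : K < y ^ a := by
            by_contra! h
            exact hy.2 ⟨hy0, h⟩
          rw [← ENNReal.ofReal_mul (by positivity)]
          refine ENNReal.ofReal_le_ofReal ?_
          have e : y ^ (a - 1) = (y ^ a) ^ (1 - p) * y ^ (a * p - 1) := by
            rw [← Real.rpow_mul hy0.le, ← Real.rpow_add hy0]
            ring_nf
          rw [e]
          exact mul_le_mul_of_nonneg_right
            (Real.rpow_le_rpow_of_nonpos hK hyK.le (by linarith)) (by positivity)
      _ = ENNReal.ofReal (K ^ (1 - p)) *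
            ∫⁻ y in E \ S, ENNReal.ofReal (y ^ (a * p - 1)) :=
          lintegral_const_mul _ (by fun_prop)
      _ ≤ ENNReal.ofReal (K ^ (1 - p)) * ENNReal.ofReal M := by
          rw [← hM]
          gcongr
          exact sdiff_subset
      _ = ENNReal.ofReal K := by
          rw [← ENNReal.ofReal_mul (by positivity), ← hKp, ← Real.rpow_add hK]
          simp
  rw [← lintegral_inter_add_sdiff _ E hSm]
  refine (add_le_add h1 h2).trans_eq ?_
  rw [← ENNReal.ofReal_add (by positivity) hK.le]
  ring_nf

theorem H0_of_nonpos {ξ x : ℝ} (f : ℝ → ℝ) (hx : x ≤ 0) : H0 ξ f x = 0 := by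
  simp [H0, Ioo_eq_empty_of_le hx]

theorem setIntegral_indicator_one_mul_rpow {ξ x : ℝ} {E : Set ℝ} (hE : MeasurableSet E) :
    ∫ y in Ioo 0 x, E.indicator 1 y * y ^ ξ = ∫ y in Ioo 0 x ∩ E, y ^ ξ := by
  rw [← setIntegral_indicator hE]
  congr 1
  ext y
  by_cases hy : y ∈ E <;> simp [hy]

theorem ofReal_abs_H0_indicator_le {ξ x : ℝ} {E : Set ℝ} (hE : MeasurableSet E) (hx : 0 < x) :
    ENNReal.ofReal |H0 ξ (E.indicator 1) x| ≤
      ENNReal.ofReal (x ^ (-(ξ + 1))) *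
        ∫⁻ y in Ioo 0 x ∩ E, ENNReal.ofReal (y ^ (ξ + 1 - 1)) := by
  rw [H0, setIntegral_indicator_one_mul_rpow hE, abs_mul,
    abs_of_nonneg (Real.rpow_nonneg hx.le _), ENNReal.ofReal_mul (Real.rpow_nonneg hx.le _)]
  have e : -ξ - 1 = -(ξ + 1) := by ring
  rw [e, add_sub_cancel_right]
  gcongr
  rw [← Real.enorm_eq_ofReal_abs]
  refine (enorm_integral_le_lintegral_enorm _).trans_eq ?_
  refine setLIntegral_congr_fun (measurableSet_Ioo.inter hE) fun y hy => ?_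
  exact Real.enorm_eq_ofReal (Real.rpow_nonneg hy.1.1.le _)

/-- The Hardy kernel `(y / x) ^ a / y` is decreasing in the exponent `a`. -/
theorem rpow_mul_lintegral_rpow_anti {a b x : ℝ} (hab : b ≤ a) {E : Set ℝ}
    (hx : 0 < x) :
    ENNReal.ofReal (x ^ (-a)) * ∫⁻ y in Ioo 0 x ∩ E, ENNReal.ofReal (y ^ (a - 1)) ≤
      ENNReal.ofReal (x ^ (-b)) * ∫⁻ y in Ioo 0 x ∩ E, ENNReal.ofReal (y ^ (b - 1)) := by
  rw [← lintegral_const_mul _ (by fun_prop), ← lintegral_const_mul _ (by fun_prop)]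
  refine setLIntegral_mono (by fun_prop) fun y hy => ?_
  have hy0 : 0 < y := hy.1.1
  rw [← ENNReal.ofReal_mul (by positivity), ← ENNReal.ofReal_mul (by positivity)]
  refine ENNReal.ofReal_le_ofReal ?_
  have key : ∀ c : ℝ, x ^ (-c) * y ^ (c - 1) = (y / x) ^ c * y⁻¹ := fun c => by
    rw [Real.rpow_sub_one hy0.ne', Real.div_rpow hy0.le hx.le, Real.rpow_neg hx.le]
    ring
  rw [key, key]
  exact mul_le_mul_of_nonneg_right (Real.rpow_le_rpow_of_exponent_ge (by positivity)
    ((div_le_one hx).2 hy.1.2.le) hab) (by positivity)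

theorem isRestrictedWeakType_H0_of_ne {ξ δ p : ℝ} (hp : 1 ≤ p) (hδ : δ ≠ -1)
    (h : δ + 1 ≤ (ξ + 1) * p) : IsRestrictedWeakType (H0 ξ) p δ := by
  have hp0 : 0 < p := by linarith
  set d := δ + 1 with hd
  have hd0 : d ≠ 0 := fun h0 => hδ (by linarith)
  set a := d / p with hadef
  have ha0 : a ≠ 0 := div_ne_zero hd0 hp0.ne'
  have hap : a * p = d := div_mul_cancel₀ d hp0.ne'
  have haξ : a ≤ ξ + 1 := (div_le_iff₀ hp0).2 h
  set c := 1 / |a| + 1 with hc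
  have hcpos : 0 < c := by positivity
  refine ⟨(c ^ p / |d|).toNNReal, fun E hE hEfin l hl => ?_⟩
  set M := (powMeasure δ E).toReal with hM
  have hM0 : 0 ≤ M := ENNReal.toReal_nonneg
  have hMeq : powMeasure δ E = ENNReal.ofReal M := (ENNReal.ofReal_toReal hEfin.ne).symm
  have hsub : {y | l < |H0 ξ (E.indicator 1) y|} ⊆
      {x : ℝ | 0 < x ∧ x ^ d ≤ c ^ p * M / l ^ p} := by
    intro x hx
    rw [mem_ofPred_eq] at hx
    have hx0 : 0 < x := by
      by_contra! h0
      rw [H0_of_nonpos _ h0, abs_zero] at hx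
      exact hl.not_gt hx
    refine ⟨hx0, ?_⟩
    have h1 : ENNReal.ofReal l ≤ ENNReal.ofReal (x ^ (-a) * (c * M ^ p⁻¹)) := by
      refine (ENNReal.ofReal_le_ofReal hx.le).trans <| (ofReal_abs_H0_indicator_le hE hx0).trans <|
        (rpow_mul_lintegral_rpow_anti haξ hx0).trans ?_
      rw [ENNReal.ofReal_mul (by positivity)]
      gcongr
      refine (lintegral_mono_set (t := E ∩ Ioi 0) fun y hy => ⟨hy.2, hy.1.1⟩).trans ?_
      refine lintegral_rpow_le_of_lintegral_rpow_eq ha0 hp (hE.inter measurableSet_Ioi)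
        inter_subset_right hM0 ?_
      rw [hap, ← hMeq, powMeasure_apply δ hE, hd, add_sub_cancel_right]
    have h2 : l ≤ x ^ (-a) * (c * M ^ p⁻¹) := (ENNReal.ofReal_le_ofReal_iff (by positivity)).1 h1
    have h3 := Real.rpow_le_rpow hl.le h2 hp0.le
    rw [Real.mul_rpow (by positivity) (by positivity), Real.mul_rpow (by positivity) (by positivity),
      Real.rpow_inv_rpow hM0 hp0.ne', ← Real.rpow_mul hx0.le, neg_mul, hap,
      Real.rpow_neg hx0.le, inv_mul_eq_div, le_div_iff₀ (by positivity)] at h3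
    rw [le_div_iff₀ (by positivity)]
    linarith
  have hmeas : powMeasure δ {x : ℝ | 0 < x ∧ x ^ d ≤ c ^ p * M / l ^ p} ≤
      ENNReal.ofReal (c ^ p * M / l ^ p / |d|) := by
    rw [powMeasure_apply δ (measurableSet_sublevel_rpow d _)]
    refine (lintegral_mono_set inter_subset_left).trans ?_
    have := lintegral_sublevel_rpow_le (K := c ^ p * M / l ^ p) hd0
    rwa [hd, add_sub_cancel_right] at this
  calc ENNReal.ofReal (l ^ p) * powMeasure δ {y | l < |H0 ξ (E.indicator 1) y|}
      ≤ ENNReal.ofReal (l ^ p) * ENNReal.ofReal (c ^ p * M / l ^ p / |d|) := by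
        gcongr
        exact (measure_mono hsub).trans hmeas
    _ = ((c ^ p / |d|).toNNReal : ℝ≥0∞) * powMeasure δ E := by
        rw [hMeq, ← ENNReal.ofReal, ← ENNReal.ofReal_mul (by positivity),
          ← ENNReal.ofReal_mul (by positivity)]
        congr 1
        field_simp

/-- The kernel `x ^ (-a - 1) * y ^ (a - 1)` restricted to `0 < y < x`, `y ∈ E`. -/
def hardyKernel (a : ℝ) (E : Set ℝ) : ℝ × ℝ → ℝ≥0∞ :=
  {q : ℝ × ℝ | q.2 ∈ Ioo 0 q.1 ∩ E}.indicator
    (fun q => ENNReal.ofReal (q.1 ^ (-a - 1)) * ENNReal.ofReal (q.2 ^ (a - 1)))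

theorem measurable_hardyKernel (a : ℝ) {E : Set ℝ} (hE : MeasurableSet E) :
    Measurable (hardyKernel a E) :=
  Measurable.indicator (by fun_prop) <|
    ((measurableSet_lt measurable_const measurable_snd).inter
      (measurableSet_lt measurable_snd measurable_fst)).inter (measurable_snd hE)

theorem lintegral_lintegral_hardyKernel {a : ℝ} (ha : 0 < a) {E : Set ℝ}
    (hE : MeasurableSet E) :
    ∫⁻ x, ∫⁻ y, hardyKernel a E (x, y) = ENNReal.ofReal (1 / a) * powMeasure (-1) E := by
  rw [lintegral_lintegral_swap (f := fun x y => hardyKernel a E (x, y))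
    (measurable_hardyKernel a hE).aemeasurable, powMeasure_apply _ hE,
    ← lintegral_const_mul _ (by fun_prop), ← lintegral_indicator (hE.inter measurableSet_Ioi)]
  refine lintegral_congr fun y => ?_
  by_cases hy : y ∈ E ∩ Ioi 0
  · have hy0 : 0 < y := hy.2
    have e : ∀ x : ℝ, hardyKernel a E (x, y) =
        (Ioi y).indicator
          (fun x => ENNReal.ofReal (y ^ (a - 1)) * ENNReal.ofReal (x ^ (-a - 1))) x := by
      intro x
      by_cases hxy : y < x
      · rw [hardyKernel, indicator_of_mem (show (x, y) ∈ {q : ℝ × ℝ | q.2 ∈ Ioo 0 q.1 ∩ E} from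
          ⟨⟨hy0, hxy⟩, hy.1⟩), indicator_of_mem (mem_Ioi.2 hxy), mul_comm]
      · rw [hardyKernel, indicator_of_notMem (fun h => hxy h.1.2), indicator_of_notMem (notMem_Ioi.2 (not_lt.1 hxy))]
    simp_rw [e]
    rw [lintegral_indicator measurableSet_Ioi, lintegral_const_mul _ (by fun_prop),
      lintegral_Ioi_rpow (neg_lt_zero.2 ha) hy0, indicator_of_mem hy,
      ← ENNReal.ofReal_mul (by positivity), ← ENNReal.ofReal_mul (by positivity)]
    congr 1
    rw [neg_neg, mul_div_assoc', ← Real.rpow_add hy0]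
    ring_nf
  · rw [indicator_of_notMem hy, lintegral_eq_zero_of_ae_eq_zero]
    refine Filter.Eventually.of_forall fun x => ?_
    exact indicator_of_notMem (fun h => hy ⟨h.2, h.1.1⟩) _

theorem isRestrictedWeakType_H0_neg_one {ξ p : ℝ} (hp : 1 ≤ p) (hξ : 0 < ξ + 1) :
    IsRestrictedWeakType (H0 ξ) p (-1) := by
  set a := ξ + 1 with ha
  refine ⟨((1 / a) ^ (p - 1) * (1 / a)).toNNReal, fun E hE hEfin l hl => ?_⟩
  by_cases hla : 1 / a ≤ l
  · have hempty : {y | l < |H0 ξ (E.indicator 1) y|} = ∅ := by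
      refine eq_empty_of_forall_notMem fun x hx => ?_
      rw [mem_ofPred_eq] at hx
      have hx0 : 0 < x := by
        by_contra! h0
        rw [H0_of_nonpos _ h0, abs_zero] at hx
        exact hl.not_gt hx
      refine hx.not_ge (le_trans ?_ hla)
      rw [← ENNReal.ofReal_le_ofReal_iff (by positivity)]
      refine (ofReal_abs_H0_indicator_le hE hx0).trans ?_
      calc _ ≤ ENNReal.ofReal (x ^ (-a)) * ∫⁻ y in Ioc 0 x, ENNReal.ofReal (y ^ (a - 1)) := by
            gcongr
            exact inter_subset_left.trans Ioo_subset_Ioc_self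
        _ = ENNReal.ofReal (1 / a) := by
            rw [lintegral_Ioc_rpow hξ hx0, ← ENNReal.ofReal_mul (by positivity),
              mul_div_assoc', ← Real.rpow_add hx0]
            simp
    simp [hempty]
  push Not at hla
  have hkm := measurable_hardyKernel a hE
  set g : ℝ → ℝ≥0∞ := fun x => ENNReal.ofReal x * ∫⁻ y, hardyKernel a E (x, y) with hg
  have hgm : Measurable g := ENNReal.measurable_ofReal.mul hkm.lintegral_prod_right'
  have hsub : {y | l < |H0 ξ (E.indicator 1) y|} ⊆ {x | ENNReal.ofReal l ≤ g x} := by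
    intro x hx
    rw [mem_ofPred_eq] at hx
    have hx0 : 0 < x := by
      by_contra! h0
      rw [H0_of_nonpos _ h0, abs_zero] at hx
      exact hl.not_gt hx
    refine (ENNReal.ofReal_le_ofReal hx.le).trans
      ((ofReal_abs_H0_indicator_le hE hx0).trans_eq ?_)
    have e : ∀ y, hardyKernel a E (x, y) = (Ioo 0 x ∩ E).indicator (fun y => ENNReal.ofReal (x ^ (-a - 1)) *
        ENNReal.ofReal (y ^ (a - 1))) y := fun y => rfl
    simp_rw [hg, e]
    rw [lintegral_indicator (measurableSet_Ioo.inter hE), lintegral_const_mul _ (by fun_prop),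
      ← mul_assoc, ← ENNReal.ofReal_mul hx0.le, Real.rpow_sub_one hx0.ne',
      mul_div_cancel₀ _ hx0.ne']
  have hint : ∫⁻ x, g x ∂(powMeasure (-1)) ≤ ENNReal.ofReal (1 / a) * powMeasure (-1) E := by
    rw [powMeasure, lintegral_withDensity_eq_lintegral_mul _ (by fun_prop) hgm, ← powMeasure,
      ← lintegral_lintegral_hardyKernel hξ hE]
    refine le_trans (setLIntegral_mono (g := fun x => ∫⁻ y, hardyKernel a E (x, y))
      hkm.lintegral_prod_right' fun x hx => le_of_eq ?_) (setLIntegral_le_lintegral _ _)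
    have hx0 : 0 < x := hx
    simp only [Pi.mul_apply, hg]
    rw [← mul_assoc, ← ENNReal.ofReal_mul (by positivity), Real.rpow_neg_one,
      inv_mul_cancel₀ hx0.ne', ENNReal.ofReal_one, one_mul]
  have hlp : l ^ p ≤ (1 / a) ^ (p - 1) * l := by
    have : l ^ p = l ^ (p - 1) * l := by
      rw [Real.rpow_sub_one hl.ne', div_mul_cancel₀ _ hl.ne']
    rw [this]
    gcongr
  calc ENNReal.ofReal (l ^ p) * powMeasure (-1) {y | l < |H0 ξ (E.indicator 1) y|}
      ≤ ENNReal.ofReal ((1 / a) ^ (p - 1) * l) *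
          powMeasure (-1) {x | ENNReal.ofReal l ≤ g x} := by
        gcongr
    _ = ENNReal.ofReal ((1 / a) ^ (p - 1)) *
          (ENNReal.ofReal l * powMeasure (-1) {x | ENNReal.ofReal l ≤ g x}) := by
        rw [ENNReal.ofReal_mul (by positivity), mul_assoc]
    _ ≤ ENNReal.ofReal ((1 / a) ^ (p - 1)) * (ENNReal.ofReal (1 / a) * powMeasure (-1) E) := by
        exact mul_le_mul_right ((mul_meas_ge_le_lintegral hgm _).trans hint) _
    _ = _ := by
        rw [← mul_assoc, ← ENNReal.ofReal_mul (by positivity)]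
        rfl

theorem integral_rpow_one_two_pos (ξ : ℝ) : 0 < ∫ u in (1:ℝ)..2, u ^ ξ := by
  refine intervalIntegral.intervalIntegral_pos_of_pos_on ?_ (fun u hu => ?_) (by norm_num)
  · refine intervalIntegral.intervalIntegrable_rpow (Or.inr ?_)
    rw [uIcc_of_le (by norm_num)]
    exact fun h => by linarith [h.1]
  · exact Real.rpow_pos_of_pos (by linarith [hu.1]) _

theorem setIntegral_Ioo_two_mul_rpow (ξ : ℝ) {ε : ℝ} (hε : 0 < ε) :
    ∫ y in Ioo ε (2 * ε), y ^ ξ = ε ^ (ξ + 1) * ∫ u in (1:ℝ)..2, u ^ ξ := by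
  rw [← integral_Ioc_eq_integral_Ioo, ← intervalIntegral.integral_of_le (by linarith)]
  have h := intervalIntegral.integral_comp_mul_left (a := 1) (b := 2) (fun y : ℝ => y ^ ξ) hε.ne'
  have h' : ∫ u in (1:ℝ)..2, (ε * u) ^ ξ = ε ^ ξ * ∫ u in (1:ℝ)..2, u ^ ξ := by
    rw [← intervalIntegral.integral_const_mul]
    refine intervalIntegral.integral_congr fun u hu => ?_
    rw [uIcc_of_le (by norm_num)] at hu
    exact Real.mul_rpow hε.le (by linarith [hu.1])
  rw [h', mul_one, mul_comm ε 2, smul_eq_mul, eq_inv_mul_iff_mul_eq₀ hε.ne'] at h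
  rw [← h, Real.rpow_add_one hε.ne']
  ring

theorem powMeasure_Ioo_two_mul (δ : ℝ) {ε : ℝ} (hε : 0 < ε) :
    powMeasure δ (Ioo ε (2 * ε)) = ENNReal.ofReal (ε ^ (δ + 1) * ∫ u in (1:ℝ)..2, u ^ δ) := by
  rw [powMeasure_apply δ measurableSet_Ioo,
    inter_eq_left.2 fun y hy => mem_Ioi.2 (hε.trans hy.1), ← setIntegral_Ioo_two_mul_rpow δ hε,
    ofReal_integral_eq_lintegral_ofReal]
  · rw [← IntegrableOn, ← integrableOn_Ioc_iff_integrableOn_Ioo,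
      ← intervalIntegrable_iff_integrableOn_Ioc_of_le (by linarith)]
    refine intervalIntegral.intervalIntegrable_rpow (Or.inr ?_)
    rw [uIcc_of_le (by linarith)]
    exact fun h => by linarith [h.1]
  · filter_upwards [ae_restrict_mem measurableSet_Ioo] with x hx
    exact Real.rpow_nonneg (hε.trans hx.1).le _

theorem H0_indicator_Ioo_two_mul (ξ : ℝ) {ε x : ℝ} (hε : 0 < ε) (hx : 2 * ε ≤ x) :
    H0 ξ ((Ioo ε (2 * ε)).indicator 1) x =
      x ^ (-ξ - 1) * (ε ^ (ξ + 1) * ∫ u in (1:ℝ)..2, u ^ ξ) := by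
  rw [H0, setIntegral_indicator_one_mul_rpow measurableSet_Ioo,
    inter_eq_right.2 (Ioo_subset_Ioo hε.le hx), setIntegral_Ioo_two_mul_rpow ξ hε]

theorem IsRestrictedWeakType.le_of_H0 {ξ δ p : ℝ} (hp : 1 ≤ p)
    (h : IsRestrictedWeakType (H0 ξ) p δ) : δ + 1 ≤ (ξ + 1) * p := by
  obtain ⟨C, hC⟩ := h
  have hp0 : 0 < p := by linarith
  set c := ∫ u in (1:ℝ)..2, u ^ ξ with hc
  set e := ∫ u in (1:ℝ)..2, u ^ δ with he
  have hc0 : 0 < c := integral_rpow_one_two_pos ξ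
  have he0 : 0 < e := integral_rpow_one_two_pos δ
  set b := min 1 ((2:ℝ) ^ (-ξ - 1)) with hb
  have hb0 : 0 < b := by positivity
  have hbx : ∀ x ∈ Ioo (1:ℝ) 2, b ≤ x ^ (-ξ - 1) := by
    intro x hx
    have hx0 : 0 < x := by linarith [hx.1]
    rcases le_total 0 (-ξ - 1) with h0 | h0
    · exact (min_le_left _ _).trans (Real.one_le_rpow hx.1.le h0)
    · exact (min_le_right _ _).trans (Real.rpow_le_rpow_of_nonpos hx0 hx.2.le h0)
  have key : ∀ ε ∈ Ioc (0:ℝ) (1 / 2), (b * c / 2) ^ p ≤ C * ε ^ (δ + 1 - (ξ + 1) * p) := by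
    rintro ε ⟨hε, hε2⟩
    have hl : 0 < b * c / 2 * ε ^ (ξ + 1) := by positivity
    have hsub : Ioo (1:ℝ) (2 * 1) ⊆
        {y | b * c / 2 * ε ^ (ξ + 1) < |H0 ξ ((Ioo ε (2 * ε)).indicator 1) y|} := by
      intro x hx
      rw [mul_one] at hx
      rw [mem_ofPred_eq, H0_indicator_Ioo_two_mul ξ hε (by linarith [hx.1]), ← hc]
      refine lt_of_lt_of_le ?_ (le_abs_self _)
      have h1 : b * (ε ^ (ξ + 1) * c) ≤ x ^ (-ξ - 1) * (ε ^ (ξ + 1) * c) :=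
        mul_le_mul_of_nonneg_right (hbx x hx) (by positivity)
      nlinarith
    have h1 := hC (Ioo ε (2 * ε)) measurableSet_Ioo
      (by rw [powMeasure_Ioo_two_mul δ hε]; exact ENNReal.ofReal_lt_top) _ hl
    have h2 := (mul_le_mul_right (measure_mono hsub) _).trans h1
    rw [powMeasure_Ioo_two_mul δ hε, powMeasure_Ioo_two_mul δ one_pos,
      ← ENNReal.ofReal_mul (by positivity), ← ENNReal.ofReal_coe_nnreal (p := C),
      ← ENNReal.ofReal_mul (by positivity), ENNReal.ofReal_le_ofReal_iff (by positivity),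
      Real.one_rpow, one_mul, ← he, ← mul_assoc, mul_le_mul_iff_left₀ he0,
      Real.mul_rpow (by positivity) (by positivity), ← Real.rpow_mul hε.le] at h2
    rw [Real.rpow_sub hε, mul_div_assoc', le_div_iff₀ (by positivity)]
    exact h2
  by_contra! hlt
  have hlim : Filter.Tendsto (fun ε : ℝ => (C : ℝ) * ε ^ (δ + 1 - (ξ + 1) * p))
      (nhdsWithin 0 (Ioi 0)) (nhds 0) := by
    have hpos : 0 < δ + 1 - (ξ + 1) * p := by linarith
    have := ((Real.continuousAt_rpow_const 0 (δ + 1 - (ξ + 1) * p) (Or.inr hpos.le)).tendsto.mono_left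
      (nhdsWithin_le_nhds (s := Ioi 0))).const_mul (C : ℝ)
    simpa [Real.zero_rpow hpos.ne'] using this
  have hle := ge_of_tendsto hlim (b := (b * c / 2) ^ p)
    (Filter.mem_of_superset (Ioc_mem_nhdsGT (by norm_num : (0:ℝ) < 1 / 2)) key)
  have : 0 < (b * c / 2) ^ p := by positivity
  linarith

theorem powMeasure_neg_one_Ioi_one : powMeasure (-1) (Ioi 1) = ⊤ := by
  rw [powMeasure_apply _ measurableSet_Ioi,
    inter_eq_left.2 (Ioi_subset_Ioi (zero_le_one (α := ℝ)))]
  by_contra hne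
  refine not_integrableOn_Ioi_inv (a := 1) ⟨by fun_prop, ?_⟩
  rw [hasFiniteIntegral_iff_ofReal]
  · refine (lintegral_congr fun x => ?_).trans_lt (lt_top_iff_ne_top.2 hne)
    rw [Real.rpow_neg_one]
  · filter_upwards [ae_restrict_mem measurableSet_Ioi] with x hx
    exact inv_nonneg.2 (zero_le_one.trans (le_of_lt hx))

theorem not_isRestrictedWeakType_H0_neg_one (p : ℝ) :
    ¬ IsRestrictedWeakType (H0 (-1)) p (-1) := by
  rintro ⟨C, hC⟩
  set c := ∫ u in (1:ℝ)..2, u ^ (-1:ℝ) with hc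
  have hc0 : 0 < c := integral_rpow_one_two_pos (-1)
  have hhalf : (0:ℝ) < 1 / 2 := by norm_num
  have hsub : Ioi (1:ℝ) ⊆
      {y | c / 2 < |H0 (-1) ((Ioo (1 / 2) (2 * (1 / 2))).indicator 1) y|} := by
    intro x hx
    rw [mem_ofPred_eq, H0_indicator_Ioo_two_mul (-1) hhalf (by linarith [mem_Ioi.1 hx]), ← hc]
    refine lt_of_lt_of_le ?_ (le_abs_self _)
    norm_num
    exact hc0
  have hfin := powMeasure_Ioo_two_mul (-1) hhalf
  have h := hC _ measurableSet_Ioo (hfin.trans_lt ENNReal.ofReal_lt_top) (c / 2) (by positivity)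
  rw [eq_top_mono (measure_mono hsub) powMeasure_neg_one_Ioi_one, hfin,
    ENNReal.mul_top (ENNReal.ofReal_pos.2 (by positivity)).ne', top_le_iff] at h
  exact ENNReal.mul_ne_top ENNReal.coe_ne_top ENNReal.ofReal_ne_top h

theorem stmt2 (ξ δ p : ℝ) (hp : 1 ≤ p) :
    IsRestrictedWeakType (H0 ξ) p δ ↔
      ((ξ = -1 → δ < (ξ + 1) * p - 1) ∧ (ξ ≠ -1 → δ ≤ (ξ + 1) * p - 1)) := by
  constructor
  · intro h
    have hle := h.le_of_H0 hp
    refine ⟨?_, fun _ => by linarith⟩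
    rintro rfl
    rcases eq_or_ne δ (-1) with rfl | hδ
    · exact absurd h (not_isRestrictedWeakType_H0_neg_one p)
    · have : δ < -1 := lt_of_le_of_ne (by linarith) hδ
      linarith
  · rintro ⟨h1, h2⟩
    have hle : δ + 1 ≤ (ξ + 1) * p := by
      by_cases hξ : ξ = -1
      · linarith [h1 hξ]
      · linarith [h2 hξ]
    rcases eq_or_ne δ (-1) with rfl | hδ
    · refine isRestrictedWeakType_H0_neg_one hp (lt_of_le_of_ne ?_ fun h0 => ?_)
      · exact nonneg_of_mul_nonneg_left (by linarith) (zero_lt_one.trans_le hp)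
      · have := h1 (by linarith)
        rw [← h0] at this
        linarith
    · exact isRestrictedWeakType_H0_of_ne hp hδ hle

end
end
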